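/- arXiv:2111.04725 — 3 statements merged into one kernel-verified Lean document; each statement's English description precedes it below -/
import Mathlib

section
/- Let G be a finite group, χ the character of a faithful finite-dimensional complex representation of G, and d ≥ 3 an integer; set Δ = (d−2)/2, and for β > 0 and g ∈ G define Z(β,g) = exp(L(β,g)) with L(β,g) = Σ_{n=1}^∞ (e^{−nβΔ}/n) (χ(gⁿ) + conj(χ(gⁿ))) (1 − e^{−2nβ})/(1 − e^{−nβ})ᵈ. Then for every non-identity element g ∈ G, lim_{β→0⁺} Z(β,g)/Z(β,1) = 0, where 1 denotes the identity of G. -/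
/-- The `n`-th term (indexing `n : ℕ` corresponds to `n + 1 ≥ 1`) of the series defining the
logarithm `L(β, g)` of the twisted partition function of a free scalar on `S^{d-1} × S¹_β`:
`(e^{-nβΔ}/n) (χ(gⁿ) + conj χ(gⁿ)) (1 - e^{-2nβ})/(1 - e^{-nβ})ᵈ` with `Δ = (d-2)/2`. -/
noncomputable def freeScalarLogTerm {G : Type*} [Group G] (χ : G → ℂ) (d : ℕ)
    (β : ℝ) (g : G) (n : ℕ) : ℂ :=
  ((Real.exp (-(((n : ℝ) + 1) * β * (((d : ℝ) - 2) / 2))) / ((n : ℝ) + 1) : ℝ) : ℂ) *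
    (χ (g ^ (n + 1)) + star (χ (g ^ (n + 1)))) *
    (((1 - Real.exp (-(2 * ((n : ℝ) + 1) * β))) /
        (1 - Real.exp (-(((n : ℝ) + 1) * β))) ^ d : ℝ) : ℂ)

/-- The twisted partition function `Z(β, g) = exp L(β, g)`. -/
noncomputable def freeScalarZ {G : Type*} [Group G] (χ : G → ℂ) (d : ℕ)
    (β : ℝ) (g : G) : ℂ :=
  Complex.exp (∑' n : ℕ, freeScalarLogTerm χ d β g n)

open Polynomial in
/-- A finite-order endomorphism of a complex vector space all of whose eigenvalues are `1` is the
identity. -/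
theorem Module.End.eq_one_of_pow_eq_one_of_roots_charpoly {V : Type*} [AddCommGroup V] [Module ℂ V]
    [FiniteDimensional ℂ V] {f : Module.End ℂ V} {N : ℕ} (hN : N ≠ 0) (hf : f ^ N = 1)
    (hroots : ∀ z ∈ (LinearMap.charpoly f).roots, z = 1) : f = 1 := by
  have hsq : Squarefree (X ^ N - 1 : ℂ[X]) :=
    (X_pow_sub_one_separable_iff.mpr (by exact_mod_cast hN)).squarefree
  have hdvd : minpoly ℂ f ∣ X ^ N - 1 := minpoly.dvd ℂ f (by simp [hf])
  have hchar : LinearMap.charpoly f = (X - C 1) ^ Multiset.card (LinearMap.charpoly f).roots := by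
    conv_lhs => rw [(IsAlgClosed.splits _).eq_prod_roots_of_monic (LinearMap.charpoly_monic f)]
    rw [Multiset.eq_replicate_card.mpr hroots]
    simp
  have hpow : minpoly ℂ f ∣ (X - C 1) ^ (Multiset.card (LinearMap.charpoly f).roots + 1) :=
    ((LinearMap.minpoly_dvd_charpoly f).trans hchar.dvd).trans (pow_dvd_pow _ (Nat.le_succ _))
  have hlin : minpoly ℂ f ∣ X - C 1 :=
    ((hsq.squarefree_of_dvd hdvd).dvd_pow_iff_dvd (Nat.succ_ne_zero _)).mp hpow
  have := (minpoly.dvd_iff).mp hlin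
  simpa [sub_eq_zero] using this

theorem Module.End.norm_eq_one_of_mem_roots_charpoly {V : Type*} [AddCommGroup V] [Module ℂ V]
    [FiniteDimensional ℂ V] {f : Module.End ℂ V} {N : ℕ} (hN : N ≠ 0) (hf : f ^ N = 1)
    {z : ℂ} (hz : z ∈ (LinearMap.charpoly f).roots) : ‖z‖ = 1 := by
  obtain ⟨v, hv⟩ := ((Module.End.hasEigenvalue_iff_isRoot_charpoly f z).mpr
    (Polynomial.isRoot_of_mem_roots hz)).exists_hasEigenvector
  have h := hv.pow_apply N
  rw [hf, Module.End.one_apply] at h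
  refine Complex.norm_eq_one_of_pow_eq_one ?_ hN
  have h2 : (z ^ N - 1) • v = 0 := by rw [sub_smul, one_smul, ← h, sub_self]
  exact sub_eq_zero.mp ((smul_eq_zero.mp h2).resolve_right hv.2)

theorem Module.End.card_roots_charpoly {V : Type*} [AddCommGroup V] [Module ℂ V]
    [FiniteDimensional ℂ V] (f : Module.End ℂ V) :
    Multiset.card (LinearMap.charpoly f).roots = Module.finrank ℂ V := by
  rw [IsAlgClosed.card_roots_eq_natDegree, LinearMap.charpoly_natDegree]

theorem Module.End.re_trace_eq_sum {V : Type*} [AddCommGroup V] [Module ℂ V]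
    [FiniteDimensional ℂ V] (f : Module.End ℂ V) :
    (LinearMap.trace ℂ V f).re = ((LinearMap.charpoly f).roots.map Complex.re).sum := by
  rw [Module.End.trace_eq_sum_roots_charpoly_of_splits (IsAlgClosed.splits _)]
  exact map_multiset_sum Complex.reAddGroupHom _

theorem Module.End.abs_re_trace_le {V : Type*} [AddCommGroup V] [Module ℂ V]
    [FiniteDimensional ℂ V] {f : Module.End ℂ V} {N : ℕ} (hN : N ≠ 0) (hf : f ^ N = 1) :
    |(LinearMap.trace ℂ V f).re| ≤ Module.finrank ℂ V := by
  rw [Module.End.re_trace_eq_sum, ← Module.End.card_roots_charpoly f]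
  refine (Multiset.abs_sum_le_sum_abs).trans ?_
  refine (Multiset.sum_le_card_nsmul _ 1 ?_).trans (by simp)
  simp only [Multiset.map_map, Multiset.mem_map, Function.comp]
  rintro _ ⟨z, hz, rfl⟩
  exact (Complex.abs_re_le_norm z).trans (norm_eq_one_of_mem_roots_charpoly hN hf hz).le

theorem Module.End.re_trace_lt {V : Type*} [AddCommGroup V] [Module ℂ V]
    [FiniteDimensional ℂ V] {f : Module.End ℂ V} {N : ℕ} (hN : N ≠ 0) (hf : f ^ N = 1)
    (hne : f ≠ 1) : (LinearMap.trace ℂ V f).re < Module.finrank ℂ V := by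
  have hle : ∀ z ∈ (LinearMap.charpoly f).roots, z.re ≤ 1 := fun z hz =>
    (Complex.re_le_norm z).trans (norm_eq_one_of_mem_roots_charpoly hN hf hz).le
  obtain ⟨z, hz, hz1⟩ : ∃ z ∈ (LinearMap.charpoly f).roots, z ≠ 1 := by
    by_contra! h
    exact hne (eq_one_of_pow_eq_one_of_roots_charpoly hN hf h)
  have hlt : z.re < 1 := by
    refine lt_of_le_of_ne (hle z hz) fun hre => hz1 ?_
    have hn := norm_eq_one_of_mem_roots_charpoly hN hf hz
    have him : z.im = 0 := by
      have := Complex.sq_norm_sub_sq_re z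
      rw [hn, hre] at this
      simpa using this.symm
    exact Complex.ext hre him
  rw [Module.End.re_trace_eq_sum, ← Module.End.card_roots_charpoly f]
  have := Multiset.sum_lt_sum (s := (LinearMap.charpoly f).roots) (g := fun _ => (1 : ℝ)) hle
    ⟨z, hz, hlt⟩
  simpa using this

/-- The character-independent factor of the `n`-th term of the free scalar series. -/
noncomputable def freeScalarWeight (d : ℕ) (β : ℝ) (n : ℕ) : ℝ :=
  Real.exp (-(((n : ℝ) + 1) * β * (((d : ℝ) - 2) / 2))) / ((n : ℝ) + 1) *
    ((1 - Real.exp (-(2 * ((n : ℝ) + 1) * β))) / (1 - Real.exp (-(((n : ℝ) + 1) * β))) ^ d)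

theorem freeScalarLogTerm_eq_ofReal {G : Type*} [Group G] (χ : G → ℂ) (d : ℕ) (β : ℝ) (g : G)
    (n : ℕ) :
    freeScalarLogTerm χ d β g n =
      ((freeScalarWeight d β n * (2 * (χ (g ^ (n + 1))).re) : ℝ) : ℂ) := by
  have h : χ (g ^ (n + 1)) + star (χ (g ^ (n + 1))) = ((2 * (χ (g ^ (n + 1))).re : ℝ) : ℂ) :=
    Complex.add_conj _
  rw [freeScalarLogTerm, freeScalarWeight, h]
  push_cast
  ring

theorem freeScalarZ_eq_ofReal {G : Type*} [Group G] (χ : G → ℂ) (d : ℕ) (β : ℝ) (g : G) :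
    freeScalarZ χ d β g =
      ((Real.exp (∑' n, freeScalarWeight d β n * (2 * (χ (g ^ (n + 1))).re)) : ℝ) : ℂ) := by
  simp only [freeScalarZ, freeScalarLogTerm_eq_ofReal, Complex.ofReal_exp, Complex.ofReal_tsum]

theorem freeScalarWeight_nonneg (d : ℕ) {β : ℝ} (hβ : 0 < β) (n : ℕ) :
    0 ≤ freeScalarWeight d β n := by
  have h1 : Real.exp (-(2 * ((n : ℝ) + 1) * β)) ≤ 1 :=
    Real.exp_le_one_iff.mpr (neg_nonpos.mpr (by positivity))
  have h2 : Real.exp (-(((n : ℝ) + 1) * β)) ≤ 1 :=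
    Real.exp_le_one_iff.mpr (neg_nonpos.mpr (by positivity))
  have h3 := sub_nonneg.mpr h1
  have h4 := sub_nonneg.mpr h2
  unfold freeScalarWeight
  positivity

theorem summable_freeScalarWeight {d : ℕ} (hd : 3 ≤ d) {β : ℝ} (hβ : 0 < β) :
    Summable (freeScalarWeight d β) := by
  have hd' : (3 : ℝ) ≤ d := by exact_mod_cast hd
  set r := Real.exp (-(β * (((d : ℝ) - 2) / 2))) with hr
  have hr1 : r < 1 := Real.exp_lt_one_iff.mpr (neg_lt_zero.mpr (mul_pos hβ (by linarith)))
  have hgeo : Summable fun n : ℕ => r ^ (n + 1) * (1 / (1 - Real.exp (-β)) ^ d) :=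
    ((summable_nat_add_iff 1).mpr
      (summable_geometric_of_lt_one (Real.exp_pos _).le hr1)).mul_right _
  refine hgeo.of_nonneg_of_le (freeScalarWeight_nonneg d hβ) fun n => ?_
  have hn : (0 : ℝ) ≤ n := n.cast_nonneg
  have hexp : Real.exp (-(((n : ℝ) + 1) * β * (((d : ℝ) - 2) / 2))) = r ^ (n + 1) := by
    rw [hr, ← Real.exp_nat_mul]
    push_cast
    ring_nf
  have hpos : 0 < 1 - Real.exp (-β) := sub_pos.mpr (Real.exp_lt_one_iff.mpr (neg_lt_zero.mpr hβ))
  have hle : 1 - Real.exp (-β) ≤ 1 - Real.exp (-(((n : ℝ) + 1) * β)) := by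
    gcongr
    nlinarith
  have h1 : Real.exp (-(2 * ((n : ℝ) + 1) * β)) ≤ 1 :=
    Real.exp_le_one_iff.mpr (neg_nonpos.mpr (by positivity))
  unfold freeScalarWeight
  rw [hexp]
  refine mul_le_mul ?_ ?_ ?_ (pow_nonneg (Real.exp_pos _).le _)
  · exact div_le_self (pow_nonneg (Real.exp_pos _).le _) (by linarith)
  · exact div_le_div₀ zero_le_one (by linarith [Real.exp_pos (-(2 * ((n : ℝ) + 1) * β))])
      (pow_pos hpos d) (pow_le_pow_left₀ hpos.le hle d)
  · exact div_nonneg (by linarith) (pow_nonneg (hpos.le.trans hle) d)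

open Filter Topology in
theorem tendsto_freeScalarWeight_zero_atTop {d : ℕ} (hd : 2 ≤ d) :
    Tendsto (fun β => freeScalarWeight d β 0) (𝓝[>] 0) atTop := by
  have h1 : Tendsto (fun β : ℝ => 1 - Real.exp (-β)) (𝓝[>] 0) (𝓝[>] 0) := by
    refine tendsto_nhdsWithin_iff.mpr ⟨?_, ?_⟩
    · have : Continuous fun β : ℝ => 1 - Real.exp (-β) := by fun_prop
      simpa using (this.tendsto 0).mono_left nhdsWithin_le_nhds
    · filter_upwards [self_mem_nhdsWithin] with β (hβ : 0 < β)
      exact sub_pos.mpr (Real.exp_lt_one_iff.mpr (neg_lt_zero.mpr hβ))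
  have h2 : Tendsto (fun β : ℝ => Real.exp (-(β * (((d : ℝ) - 2) / 2)))) (𝓝[>] 0) (𝓝 1) := by
    have : Continuous fun β : ℝ => Real.exp (-(β * (((d : ℝ) - 2) / 2))) := by fun_prop
    simpa using (this.tendsto 0).mono_left nhdsWithin_le_nhds
  refine tendsto_atTop_mono' _ ?_ (h2.pos_mul_atTop one_pos h1.inv_tendsto_nhdsGT_zero)
  filter_upwards [self_mem_nhdsWithin] with β (hβ : 0 < β)
  have hpos : 0 < 1 - Real.exp (-β) := sub_pos.mpr (Real.exp_lt_one_iff.mpr (neg_lt_zero.mpr hβ))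
  have hexp := Real.exp_pos (-β)
  have hsq : Real.exp (-(2 * β)) = Real.exp (-β) ^ 2 := by
    rw [← Real.exp_nat_mul]
    push_cast
    ring_nf
  have hpow : (1 - Real.exp (-β)) ^ d ≤ (1 - Real.exp (-β)) ^ 2 :=
    pow_le_pow_of_le_one hpos.le (by linarith) hd
  simp only [freeScalarWeight, Nat.cast_zero, zero_add, one_mul, div_one, mul_one, Pi.inv_apply]
  refine mul_le_mul_of_nonneg_left ?_ (Real.exp_pos _).le
  calc (1 - Real.exp (-β))⁻¹ = (1 - Real.exp (-β)) / (1 - Real.exp (-β)) ^ 2 := by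
        field_simp
    _ ≤ (1 - Real.exp (-(2 * β))) / (1 - Real.exp (-β)) ^ d := by
        refine div_le_div₀ ?_ ?_ (pow_pos hpos d) hpow <;> rw [hsq] <;> nlinarith

open Filter Topology in
/-- The suppression of `Z(β, g)` relative to `Z(β, 1)` for a function `χ` whose real part is
bounded by `χ 1`, strictly at `g`. -/
theorem tendsto_freeScalarZ_div_of_re_lt {G : Type*} [Group G] {χ : G → ℂ}
    (hχ : ∀ h, |(χ h).re| ≤ (χ 1).re) {d : ℕ} (hd : 3 ≤ d) {g : G}
    (hg : (χ g).re < (χ 1).re) :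
    Tendsto (fun β : ℝ => freeScalarZ χ d β g / freeScalarZ χ d β 1) (𝓝[>] 0) (𝓝 0) := by
  have hbot : Tendsto (fun β => freeScalarWeight d β 0 * (2 * ((χ g).re - (χ 1).re)))
      (𝓝[>] 0) atBot :=
    (tendsto_freeScalarWeight_zero_atTop (by lia)).atTop_mul_const_of_neg (by linarith)
  have hsum : ∀ {β : ℝ}, 0 < β → ∀ h : G,
      Summable fun n => freeScalarWeight d β n * (2 * (χ (h ^ (n + 1))).re) := by
    intro β hβ h
    refine ((summable_freeScalarWeight hd hβ).mul_right (2 * (χ 1).re)).of_norm_bounded fun n => ?_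
    rw [norm_mul, Real.norm_of_nonneg (freeScalarWeight_nonneg d hβ n), norm_mul, Real.norm_two,
      Real.norm_eq_abs]
    exact mul_le_mul_of_nonneg_left (by linarith [hχ (h ^ (n + 1))])
      (freeScalarWeight_nonneg d hβ n)
  have hreal : Tendsto (fun β : ℝ => Real.exp
      (∑' n, freeScalarWeight d β n * (2 * (χ (g ^ (n + 1))).re) -
        ∑' n, freeScalarWeight d β n * (2 * (χ (1 ^ (n + 1))).re))) (𝓝[>] 0) (𝓝 0) := by
    refine Real.tendsto_exp_atBot.comp (tendsto_atBot_mono' _ ?_ hbot)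
    filter_upwards [self_mem_nhdsWithin] with β (hβ : 0 < β)
    have hfirst := ((hsum hβ 1).sub (hsum hβ g)).le_tsum 0 fun n _ => by
      rw [one_pow, ← mul_sub]
      exact mul_nonneg (freeScalarWeight_nonneg d hβ n)
        (by linarith [(abs_le.mp (hχ (g ^ (n + 1)))).2])
    rw [(hsum hβ 1).tsum_sub (hsum hβ g)] at hfirst
    simp only [zero_add, pow_one] at hfirst
    linarith
  have hofReal := (Complex.continuous_ofReal.tendsto 0).comp hreal
  rw [Complex.ofReal_zero] at hofReal
  refine hofReal.congr fun β => ?_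
  simp only [Function.comp, freeScalarZ_eq_ofReal, Real.exp_sub, Complex.ofReal_div]

/-- For the character `χ` of a faithful finite-dimensional complex representation
of a finite group `G` and an integer `d ≥ 3`, for every non-identity `g ∈ G` the twisted
partition function satisfies `Z(β, g)/Z(β, 1) → 0` as `β → 0⁺`. -/
theorem freeScalarZ_twisted_suppressed
    {G : Type*} [Group G] [Fintype G]
    {V : Type*} [AddCommGroup V] [Module ℂ V] [FiniteDimensional ℂ V]
    (ρ : Representation ℂ G V) (hfaith : Function.Injective ρ)
    (d : ℕ) (hd : 3 ≤ d) (g : G) (hg : g ≠ 1) :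
    Filter.Tendsto
      (fun β : ℝ =>
        freeScalarZ (fun h => LinearMap.trace ℂ V (ρ h)) d β g /
          freeScalarZ (fun h => LinearMap.trace ℂ V (ρ h)) d β 1)
      (nhdsWithin 0 (Set.Ioi 0)) (nhds 0) := by
  have hcard : Fintype.card G ≠ 0 := Fintype.card_ne_zero
  have hpow : ∀ h : G, ρ h ^ Fintype.card G = 1 := fun h => by
    rw [← map_pow, pow_card_eq_one, map_one]
  have hone : (LinearMap.trace ℂ V (ρ 1)).re = Module.finrank ℂ V := by
    rw [map_one, LinearMap.trace_one, Complex.natCast_re]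
  refine tendsto_freeScalarZ_div_of_re_lt (fun h => ?_) hd ?_
  · rw [hone]
    exact Module.End.abs_re_trace_le hcard (hpow h)
  · rw [hone]
    exact Module.End.re_trace_lt hcard (hpow g) fun h => hg (hfaith (h.trans (map_one ρ).symm))
end

section
/- For x ∈ ℝ define B₊(x) = (2 sin²(πx)/π²)·[Σ_{k=0}^∞ 1/(x−k)² + 1/x] − 1 (extended continuously across the removable singularities at nonnegative integers and at 0), and for δ > 0 define φ₊(x) = ½ B₊(δ+x) + ½ B₊(δ−x). Then φ₊(x) ≥ 1_{[−δ,δ]}(x) for all x ∈ ℝ; that is, φ₊(x) ≥ 1 for x ∈ [−δ,δ] and φ₊(x) ≥ 0 for all x ∈ ℝ. -/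
open Classical in
/-- The Beurling–Selberg majorant building block
`B₊(x) = (2 sin²(πx)/π²)(Σ_{k=0}^∞ 1/(x-k)² + 1/x) - 1`, extended continuously across the
removable singularities at the nonnegative integers (where its value is `1`). -/
noncomputable def Bplus (x : ℝ) : ℝ :=
  if ∃ n : ℕ, x = (n : ℝ) then 1
  else 2 * Real.sin (Real.pi * x) ^ 2 / Real.pi ^ 2 *
    ((∑' k : ℕ, 1 / (x - (k : ℝ)) ^ 2) + 1 / x) - 1

open Classical in
/-- The Beurling–Selberg minorant building block
`B₋(x) = (2 sin²(πx)/π²)(Σ_{k=1}^∞ 1/(x-k)² + 1/x) - 1`, extended continuously across the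
removable singularities at the positive integers (where its value is `1`); at `x = 0` the
formula itself is continuous with value `-1` (in Lean `1/0 = 0`). -/
noncomputable def Bminus (x : ℝ) : ℝ :=
  if ∃ n : ℕ, 0 < n ∧ x = (n : ℝ) then 1
  else 2 * Real.sin (Real.pi * x) ^ 2 / Real.pi ^ 2 *
    ((∑' k : ℕ, 1 / (x - ((k : ℝ) + 1)) ^ 2) + 1 / x) - 1

/-- The Beurling–Selberg majorant `φ₊(x) = ½ B₊(δ+x) + ½ B₊(δ-x)` of `1_{[-δ,δ]}`. -/
noncomputable def phiPlus (δ x : ℝ) : ℝ := Bplus (δ + x) / 2 + Bplus (δ - x) / 2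

/-- The Beurling–Selberg minorant `φ₋(x) = ½ B₋(δ+x) + ½ B₋(δ-x)` of `1_{(-δ,δ)}`. -/
noncomputable def phiMinus (δ x : ℝ) : ℝ := Bminus (δ + x) / 2 + Bminus (δ - x) / 2

/-- Parseval's identity for `t ↦ exp (2πixt)` on `(0, 1]`. -/
theorem hasSum_sin_sq_div_sub_int_sq {x : ℝ} (hx : ∀ n : ℤ, x ≠ n) :
    HasSum (fun n : ℤ => Real.sin (Real.pi * x) ^ 2 / (Real.pi ^ 2 * (x - n) ^ 2)) 1 := by
  have hcont : Continuous fun t : ℝ => Complex.exp (2 * Real.pi * Complex.I * x * t) := by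
    fun_prop
  have hnorm (t : ℝ) : ‖Complex.exp (2 * Real.pi * Complex.I * x * t)‖ = 1 := by
    rw [show (2 * Real.pi * Complex.I * x * t : ℂ) =
      ((2 * Real.pi * x * t : ℝ) : ℂ) * Complex.I by push_cast; ring]
    exact Complex.norm_exp_ofReal_mul_I _
  have hL2 : MeasureTheory.MemLp (fun t : ℝ => Complex.exp (2 * Real.pi * Complex.I * x * t)) 2
      (MeasureTheory.volume.restrict (Set.Ioc (0 : ℝ) 1)) :=
    MeasureTheory.MemLp.of_bound hcont.aestronglyMeasurable 1
      (Filter.Eventually.of_forall fun t => (hnorm t).le)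
  have h := hasSum_sq_fourierCoeffOn zero_lt_one hL2
  simp only [hnorm] at h
  convert h using 1
  · ext n
    have hxn : x - n ≠ 0 := sub_ne_zero.mpr (hx n)
    have hc : (2 * Real.pi * Complex.I * (x - n) : ℂ) ≠ 0 := by
      have : (x - n : ℂ) ≠ 0 := by exact_mod_cast hxn
      simp [Real.pi_ne_zero, this]
    have hcoeff : fourierCoeffOn zero_lt_one
        (fun t : ℝ => Complex.exp (2 * Real.pi * Complex.I * x * t)) n =
        (Complex.exp (Complex.I * (2 * Real.pi * (x - n) : ℝ)) - 1) /
          (2 * Real.pi * Complex.I * (x - n)) := by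
      rw [fourierCoeffOn_eq_integral]
      have : ∀ t : ℝ, fourier (-n) (t : AddCircle (1 - 0 : ℝ)) •
          Complex.exp (2 * Real.pi * Complex.I * x * t) =
          Complex.exp (2 * Real.pi * Complex.I * (x - n) * t) := by
        intro t
        rw [fourier_coe_apply, smul_eq_mul, ← Complex.exp_add]
        congr 1
        push_cast
        ring
      simp only [this]
      rw [integral_exp_mul_complex hc]
      simp only [sub_zero, div_one, one_smul, Complex.ofReal_one, mul_one, Complex.ofReal_zero,
        mul_zero, Complex.exp_zero]
      congr 3
      push_cast
      ring
    have hden : ‖(2 * Real.pi * Complex.I * (x - n) : ℂ)‖ = |2 * Real.pi * (x - n)| := by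
      rw [← Real.norm_eq_abs, ← Complex.norm_real]
      simp
    have hsin : Real.sin (2 * Real.pi * (x - n) / 2) ^ 2 = Real.sin (Real.pi * x) ^ 2 := by
      rw [show 2 * Real.pi * (x - n) / 2 = Real.pi * x - n * Real.pi by ring,
        Real.sin_sub_int_mul_pi, mul_pow, ← zpow_natCast, ← zpow_mul, mul_comm n,
        zpow_mul]
      simp
    rw [hcoeff, norm_div, Complex.norm_exp_I_mul_ofReal_sub_one, hden, div_pow, Real.norm_eq_abs,
      sq_abs, sq_abs, mul_pow 2 (Real.sin _), hsin]
    field_simp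
  · simp

theorem tsum_one_div_add_nat_add_one_sq_le {x : ℝ} (hx : 0 < x) :
    ∑' k : ℕ, 1 / (x + (k + 1)) ^ 2 ≤ 1 / x := by
  refine Real.tsum_le_of_sum_range_le (fun k => by positivity) fun n => ?_
  have h (n : ℕ) : ∑ k ∈ Finset.range n, 1 / (x + (k + 1)) ^ 2 ≤ 1 / x - 1 / (x + n) := by
    induction n with
    | zero => simp
    | succ n ih =>
      rw [Finset.sum_range_succ]
      have : 1 / (x + (n + 1)) ^ 2 ≤ 1 / (x + n) - 1 / (x + (n + 1)) := by
        rw [div_sub_div _ _ (by positivity) (by positivity),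
          div_le_div_iff₀ (by positivity) (by positivity)]
        have : 0 < x + n := by positivity
        nlinarith
      push_cast
      linarith
  have : 0 ≤ 1 / (x + n) := by positivity
  linarith [h n]

theorem summable_one_div_sub_nat_sq (x : ℝ) : Summable fun k : ℕ => 1 / (x - k) ^ 2 := by
  have h := (Real.summable_one_div_nat_add_rpow (-x) 2).mpr one_lt_two
  refine h.congr fun k => ?_
  rw [Real.rpow_two, sq_abs, ← sub_eq_add_neg, ← neg_sub, neg_sq]

theorem one_div_le_tsum_one_div_add_nat_sq {y : ℝ} (hy : 0 < y) :
    1 / y ≤ ∑' k : ℕ, 1 / (y + k) ^ 2 := by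
  have hs : Summable fun k : ℕ => 1 / (y + k) ^ 2 := by
    refine (summable_one_div_sub_nat_sq (-y)).congr fun k => ?_
    rw [← neg_sq, neg_sub, sub_neg_eq_add, add_comm]
  have h (n : ℕ) : 1 / y - 1 / (y + n) ≤ ∑ k ∈ Finset.range n, 1 / (y + k) ^ 2 := by
    induction n with
    | zero => simp
    | succ n ih =>
      rw [Finset.sum_range_succ]
      have : 1 / (y + n) - 1 / (y + (n + 1)) ≤ 1 / (y + n) ^ 2 := by
        have : 0 < y + n := by positivity
        rw [div_sub_div _ _ (by positivity) (by positivity),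
          div_le_div_iff₀ (by positivity) (by positivity)]
        nlinarith
      push_cast
      linarith
  have hlim : Filter.Tendsto (fun n : ℕ => 1 / y - 1 / (y + n)) Filter.atTop (nhds (1 / y)) := by
    have : Filter.Tendsto (fun n : ℕ => y + (n : ℝ)) Filter.atTop Filter.atTop :=
      Filter.tendsto_atTop_add_const_left _ _ tendsto_natCast_atTop_atTop
    simpa using tendsto_const_nhds (x := 1 / y).sub (this.inv_tendsto_atTop)
  exact le_of_tendsto_of_tendsto' hlim hs.hasSum.tendsto_sum_nat h

theorem neg_one_le_Bplus_of_neg {x : ℝ} (hx : x < 0) : -1 ≤ Bplus x := by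
  rw [Bplus]
  split_ifs
  · norm_num
  have h := one_div_le_tsum_one_div_add_nat_sq (neg_pos.mpr hx)
  have heq : ∑' k : ℕ, 1 / (-x + k) ^ 2 = ∑' k : ℕ, 1 / (x - k) ^ 2 :=
    tsum_congr fun k => by rw [← neg_sq, neg_add, neg_neg, ← sub_eq_add_neg]
  rw [heq, one_div_neg_eq_neg_one_div] at h
  have : 0 ≤ (∑' k : ℕ, 1 / (x - k) ^ 2) + 1 / x := by linarith
  have : 0 ≤ 2 * Real.sin (Real.pi * x) ^ 2 / Real.pi ^ 2 *
    ((∑' k : ℕ, 1 / (x - (k : ℝ)) ^ 2) + 1 / x) := by positivity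
  linarith

theorem one_le_Bplus_of_nonneg {x : ℝ} (hx : 0 ≤ x) : 1 ≤ Bplus x := by
  rw [Bplus]
  split_ifs with hn
  · rfl
  have hint (n : ℤ) : x ≠ n := by
    rintro rfl
    lift n to ℕ using by exact_mod_cast hx
    exact hn ⟨n, by simp⟩
  have hpos : 0 < x := hx.lt_of_ne' (by simpa using hint 0)
  set c := Real.sin (Real.pi * x) ^ 2 / Real.pi ^ 2 with hc
  have hs : Summable fun k : ℕ => 1 / (x + (k + 1)) ^ 2 := by
    refine ((summable_nat_add_iff 1).mpr (summable_one_div_sub_nat_sq (-x))).congr fun k => ?_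
    push_cast
    rw [← neg_sq, neg_sub, sub_neg_eq_add, add_comm]
  have hsum := ((summable_one_div_sub_nat_sq x).hasSum.mul_left c).of_nat_of_neg_add_one
    (f := fun n : ℤ => c * (1 / (x - n) ^ 2)) (by
      convert hs.hasSum.mul_left c using 4 with k
      push_cast
      ring)
  have hone : HasSum (fun n : ℤ => c * (1 / (x - n) ^ 2)) 1 := by
    refine (hasSum_sin_sq_div_sub_int_sq hint).congr_fun fun n => ?_
    rw [hc, div_mul_div_comm, mul_one]
  have heq := hsum.unique hone
  have hle := mul_le_mul_of_nonneg_left (tsum_one_div_add_nat_add_one_sq_le hpos)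
    (by positivity : 0 ≤ c)
  rw [mul_div_assoc, mul_assoc, mul_add]
  linarith

/-- The Beurling–Selberg majorant `φ₊` majorizes the indicator function of the
closed interval `[-δ,δ]`: `φ₊(x) ≥ 1` for `x ∈ [-δ,δ]` and `φ₊(x) ≥ 0` for all `x ∈ ℝ`. -/
theorem phiPlus_majorant (δ : ℝ) (hδ : 0 < δ) :
    (∀ x : ℝ, Set.indicator (Set.Icc (-δ) δ) 1 x ≤ phiPlus δ x) ∧
    (∀ x ∈ Set.Icc (-δ) δ, 1 ≤ phiPlus δ x) ∧
    (∀ x : ℝ, 0 ≤ phiPlus δ x) := by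
  have hin : ∀ x ∈ Set.Icc (-δ) δ, 1 ≤ phiPlus δ x := by
    rintro x ⟨h₁, h₂⟩
    have := one_le_Bplus_of_nonneg (x := δ + x) (by linarith)
    have := one_le_Bplus_of_nonneg (x := δ - x) (by linarith)
    rw [phiPlus]
    linarith
  have hall : ∀ x : ℝ, 0 ≤ phiPlus δ x := by
    intro x
    by_cases hx : x ∈ Set.Icc (-δ) δ
    · linarith [hin x hx]
    rw [phiPlus]
    rcases lt_or_ge x (-δ) with h | h
    · have := neg_one_le_Bplus_of_neg (x := δ + x) (by linarith)
      have := one_le_Bplus_of_nonneg (x := δ - x) (by linarith)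
      linarith
    · have h' : δ < x := by
        by_contra! h'
        exact hx ⟨h, h'⟩
      have := one_le_Bplus_of_nonneg (x := δ + x) (by linarith)
      have := neg_one_le_Bplus_of_neg (x := δ - x) (by linarith)
      linarith
  exact ⟨fun x => Set.indicator_le' hin (fun x _ => hall x) x, hin, hall⟩
end

section
/- For x ∈ ℝ define B₋(x) = (2 sin²(πx)/π²)·[Σ_{k=1}^∞ 1/(x−k)² + 1/x] − 1 (extended continuously across the removable singularities at positive integers and at 0), and for δ > 0 define φ₋(x) = ½ B₋(δ+x) + ½ B₋(δ−x). Then φ₋(x) ≤ 1_{(−δ,δ)}(x) for all x ∈ ℝ; that is, φ₋(x) ≤ 1 for x ∈ (−δ,δ) and φ₋(x) ≤ 0 for all x ∉ (−δ,δ). -/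
/-- The duplication formula for `1 / sin²`. -/
lemma inv_sin_sq_eq_half_angle (t : ℝ) (h : Real.sin t ≠ 0) :
    1 / Real.sin (t / 2) ^ 2 + 1 / Real.sin (t / 2 + Real.pi / 2) ^ 2 =
      4 * (1 / Real.sin t ^ 2) := by
  have ht : Real.sin t = 2 * Real.sin (t / 2) * Real.cos (t / 2) := by
    rw [← Real.sin_two_mul]; ring_nf
  rw [Real.sin_add_pi_div_two]
  rw [ht] at h ⊢
  have h1 : Real.sin (t / 2) ≠ 0 := by rintro h0; simp [h0] at h
  have h2 : Real.cos (t / 2) ≠ 0 := by rintro h0; simp [h0] at h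
  have h3 := Real.sin_sq_add_cos_sq (t / 2)
  field_simp
  linarith

/-- Iterating the duplication formula for `1 / sin²`. -/
lemma sum_inv_sin_sq_two_pow (y : ℝ) (h : Real.sin y ≠ 0) (n : ℕ) :
    (∀ k : ℕ, Real.sin ((y + k * Real.pi) / 2 ^ n) ≠ 0) ∧
    ∑ k ∈ Finset.range (2 ^ n), 1 / Real.sin ((y + k * Real.pi) / 2 ^ n) ^ 2 =
      4 ^ n * (1 / Real.sin y ^ 2) := by
  induction n with
  | zero =>
    refine ⟨fun k => ?_, by simp⟩
    simp [Real.sin_add_nat_mul_pi, h]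
  | succ n ih =>
    obtain ⟨hne, hsum⟩ := ih
    constructor
    · intro k h0
      apply hne k
      have : (y + k * Real.pi) / 2 ^ n = 2 * ((y + k * Real.pi) / 2 ^ (n + 1)) := by
        rw [pow_succ]; field_simp
      rw [this, Real.sin_two_mul, h0]; ring
    · have hN : 2 ^ (n + 1) = 2 ^ n + 2 ^ n := by ring
      rw [hN, Finset.sum_range_add, ← Finset.sum_add_distrib, pow_succ (4 : ℝ),
        mul_comm ((4 : ℝ) ^ n), mul_assoc, ← hsum, Finset.mul_sum]
      refine Finset.sum_congr rfl fun k _ => ?_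
      rw [← inv_sin_sq_eq_half_angle _ (hne k)]
      congr 4
      · rw [pow_succ]; field_simp
      · push_cast
        rw [pow_succ]; field_simp; ring

lemma sum_inv_sq_two_pow_le (z : ℝ) (h : Real.sin (Real.pi * z) ≠ 0) (n : ℕ) :
    ∑ j ∈ Finset.range (2 ^ n), 1 / (z + j) ^ 2 ≤
      Real.pi ^ 2 / Real.sin (Real.pi * z) ^ 2 := by
  obtain ⟨hne, hsum⟩ := sum_inv_sin_sq_two_pow _ h n
  have key : ∀ j : ℕ, 1 / (z + j) ^ 2 ≤
      Real.pi ^ 2 / 4 ^ n * (1 / Real.sin ((Real.pi * z + j * Real.pi) / 2 ^ n) ^ 2) := by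
    intro j
    have hs := hne j
    have hpi := Real.pi_pos
    have h4 : (4 : ℝ) ^ n = (2 ^ n) ^ 2 := by rw [← pow_mul, mul_comm, pow_mul]; norm_num
    have hle : Real.sin ((Real.pi * z + j * Real.pi) / 2 ^ n) ^ 2 ≤
        ((Real.pi * z + j * Real.pi) / 2 ^ n) ^ 2 := sq_le_sq.mpr Real.abs_sin_le_abs
    have hzj : z + j ≠ 0 := by
      intro h0
      apply hs
      rw [show Real.pi * z + j * Real.pi = Real.pi * (z + j) by ring, h0]
      simp
    have := one_div_le_one_div_of_le (by positivity) hle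
    calc 1 / (z + j) ^ 2
        = Real.pi ^ 2 / 4 ^ n * (1 / ((Real.pi * z + j * Real.pi) / 2 ^ n) ^ 2) := by
          rw [h4, show Real.pi * z + j * Real.pi = Real.pi * (z + j) by ring]
          field_simp
      _ ≤ _ := by gcongr
  calc _ ≤ ∑ j ∈ Finset.range (2 ^ n),
        Real.pi ^ 2 / 4 ^ n * (1 / Real.sin ((Real.pi * z + j * Real.pi) / 2 ^ n) ^ 2) :=
        Finset.sum_le_sum fun j _ => key j
    _ = _ := by
      rw [← Finset.mul_sum, hsum]
      field_simp

lemma one_div_sub_le_sum_inv_sq (x : ℝ) (hx : 0 < x) (n : ℕ) :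
    1 / x - 1 / (x + n) ≤ ∑ j ∈ Finset.range n, 1 / (x + j) ^ 2 := by
  induction n with
  | zero => simp
  | succ n ih =>
    rw [Finset.sum_range_succ]
    have hn : 0 < x + n := by positivity
    have : 1 / (x + n) - 1 / (x + (n + 1 : ℕ)) ≤ 1 / (x + n) ^ 2 := by
      push_cast
      rw [div_sub_div _ _ (by positivity) (by positivity), div_le_div_iff₀ (by positivity)
        (by positivity)]
      nlinarith
    linarith

lemma sum_inv_sq_le_one_div (y : ℝ) (hy : 0 < y) (n : ℕ) :
    ∑ j ∈ Finset.range n, 1 / (y + (j + 1)) ^ 2 ≤ 1 / y - 1 / (y + n) := by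
  induction n with
  | zero => simp
  | succ n ih =>
    rw [Finset.sum_range_succ]
    have hn : 0 < y + n := by positivity
    have : 1 / (y + (n + 1)) ^ 2 ≤ 1 / (y + n) - 1 / (y + (n + 1 : ℕ)) := by
      push_cast
      rw [div_sub_div _ _ (by positivity) (by positivity), div_le_div_iff₀ (by positivity)
        (by positivity)]
      nlinarith
    linarith

lemma tsum_inv_sq_add_one_div_le (x : ℝ) (hx : 0 < x) (h : Real.sin (Real.pi * x) ≠ 0) :
    (∑' k : ℕ, 1 / (x - ((k : ℝ) + 1)) ^ 2) + 1 / x ≤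
      Real.pi ^ 2 / Real.sin (Real.pi * x) ^ 2 := by
  rw [← le_sub_iff_add_le]
  refine Real.tsum_le_of_sum_range_le (fun k => by positivity) fun m => ?_
  have hsin (n : ℕ) : Real.sin (Real.pi * (x - (2 ^ n : ℕ))) ^ 2 = Real.sin (Real.pi * x) ^ 2 := by
    rw [mul_sub, mul_comm Real.pi ((2 ^ n : ℕ) : ℝ), Real.sin_sub_nat_mul_pi, mul_pow, ← pow_mul,
      mul_comm (2 ^ n), pow_mul]
    simp
  have hbound (n : ℕ) (hn : m ≤ n) : ∑ k ∈ Finset.range m, 1 / (x - ((k : ℝ) + 1)) ^ 2 ≤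
      Real.pi ^ 2 / Real.sin (Real.pi * x) ^ 2 - 1 / x + 1 / (x + (2 ^ n : ℕ)) := by
    have h1 := sum_inv_sq_two_pow_le (x - (2 ^ n : ℕ)) (by
      rw [← pow_ne_zero_iff two_ne_zero, hsin]; positivity) (n + 1)
    rw [hsin, show 2 ^ (n + 1) = 2 ^ n + 2 ^ n by ring, Finset.sum_range_add,
      ← Finset.sum_range_reflect] at h1
    have h2 : ∑ j ∈ Finset.range (2 ^ n), 1 / (x - (2 ^ n : ℕ) + (2 ^ n - 1 - j : ℕ)) ^ 2 =
        ∑ k ∈ Finset.range (2 ^ n), 1 / (x - ((k : ℝ) + 1)) ^ 2 := by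
      refine Finset.sum_congr rfl fun j hj => ?_
      have hj := Finset.mem_range.mp hj
      rw [Nat.sub_sub, Nat.cast_sub (by omega)]
      push_cast
      ring_nf
    have h3 : ∑ j ∈ Finset.range (2 ^ n), 1 / (x - (2 ^ n : ℕ) + (2 ^ n + j : ℕ)) ^ 2 =
        ∑ j ∈ Finset.range (2 ^ n), 1 / (x + j) ^ 2 := by
      refine Finset.sum_congr rfl fun j _ => ?_
      push_cast
      ring_nf
    rw [h2, h3] at h1
    have h4 := one_div_sub_le_sum_inv_sq x hx (2 ^ n)
    have h5 : ∑ k ∈ Finset.range m, 1 / (x - ((k : ℝ) + 1)) ^ 2 ≤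
        ∑ k ∈ Finset.range (2 ^ n), 1 / (x - ((k : ℝ) + 1)) ^ 2 :=
      Finset.sum_le_sum_of_subset_of_nonneg
        (Finset.range_subset_range.mpr (hn.trans Nat.lt_two_pow_self.le))
        fun _ _ _ => by positivity
    linarith
  have hlim : Filter.Tendsto (fun n : ℕ => Real.pi ^ 2 / Real.sin (Real.pi * x) ^ 2 - 1 / x +
      1 / (x + (2 ^ n : ℕ))) Filter.atTop
      (nhds (Real.pi ^ 2 / Real.sin (Real.pi * x) ^ 2 - 1 / x + 0)) := by
    refine tendsto_const_nhds.add ?_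
    simp_rw [one_div]
    refine Filter.Tendsto.inv_tendsto_atTop (Filter.tendsto_atTop_add_const_left _ _ ?_)
    exact tendsto_natCast_atTop_atTop.comp (tendsto_pow_atTop_atTop_of_one_lt one_lt_two)
  rw [add_zero] at hlim
  exact ge_of_tendsto hlim (Filter.eventually_atTop.mpr ⟨m, hbound⟩)

lemma Bminus_le_neg_one (x : ℝ) (hx : x ≤ 0) : Bminus x ≤ -1 := by
  have hn : ¬ ∃ n : ℕ, 0 < n ∧ x = (n : ℝ) := by
    rintro ⟨n, hn, rfl⟩
    have : (0 : ℝ) < n := by exact_mod_cast hn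
    linarith
  rw [Bminus, if_neg hn]
  rcases hx.eq_or_lt with rfl | hx
  · simp
  have hT : (∑' k : ℕ, 1 / (x - ((k : ℝ) + 1)) ^ 2) ≤ 1 / (-x) := by
    refine Real.tsum_le_of_sum_range_le (fun k => by positivity) fun m => ?_
    have h1 := sum_inv_sq_le_one_div (-x) (by linarith) m
    have h2 : 0 ≤ 1 / (-x + m) := by
      have : 0 < -x := by linarith
      positivity
    have h3 : ∑ j ∈ Finset.range m, 1 / (x - ((j : ℝ) + 1)) ^ 2 =
        ∑ j ∈ Finset.range m, 1 / (-x + ((j : ℝ) + 1)) ^ 2 :=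
      Finset.sum_congr rfl fun j _ => by ring_nf
    linarith
  rw [one_div_neg_eq_neg_one_div] at hT
  have := mul_nonpos_of_nonneg_of_nonpos
    (show 0 ≤ 2 * Real.sin (Real.pi * x) ^ 2 / Real.pi ^ 2 by positivity)
    (show (∑' k : ℕ, 1 / (x - ((k : ℝ) + 1)) ^ 2) + 1 / x ≤ 0 by linarith)
  linarith

lemma Bminus_le_one (x : ℝ) : Bminus x ≤ 1 := by
  rcases le_or_gt x 0 with hx | hx
  · linarith [Bminus_le_neg_one x hx]
  rw [Bminus]
  split_ifs
  · exact le_rfl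
  by_cases hs : Real.sin (Real.pi * x) = 0
  · simp [hs]
  have hpi := Real.pi_ne_zero
  have := mul_le_mul_of_nonneg_left (tsum_inv_sq_add_one_div_le x hx hs)
    (show 0 ≤ 2 * Real.sin (Real.pi * x) ^ 2 / Real.pi ^ 2 by positivity)
  have h2 : 2 * Real.sin (Real.pi * x) ^ 2 / Real.pi ^ 2 *
      (Real.pi ^ 2 / Real.sin (Real.pi * x) ^ 2) = 2 := by field_simp
  linarith

/-- The Beurling–Selberg minorant `φ₋` minorizes the indicator function of the
open interval `(-δ,δ)`: `φ₋(x) ≤ 1` for `x ∈ (-δ,δ)` and `φ₋(x) ≤ 0` for `x ∉ (-δ,δ)`. -/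
theorem phiMinus_minorant (δ : ℝ) (hδ : 0 < δ) :
    (∀ x : ℝ, phiMinus δ x ≤ Set.indicator (Set.Ioo (-δ) δ) 1 x) ∧
    (∀ x ∈ Set.Ioo (-δ) δ, phiMinus δ x ≤ 1) ∧
    (∀ x : ℝ, x ∉ Set.Ioo (-δ) δ → phiMinus δ x ≤ 0) := by
  have hin (x : ℝ) : phiMinus δ x ≤ 1 := by
    unfold phiMinus
    linarith [Bminus_le_one (δ + x), Bminus_le_one (δ - x)]
  have hout (x : ℝ) (hx : x ∉ Set.Ioo (-δ) δ) : phiMinus δ x ≤ 0 := by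
    unfold phiMinus
    rcases le_or_gt x (-δ) with h | h
    · linarith [Bminus_le_neg_one (δ + x) (by linarith), Bminus_le_one (δ - x)]
    · have h' : δ ≤ x := not_lt.mp fun h' => hx ⟨h, h'⟩
      linarith [Bminus_le_neg_one (δ - x) (by linarith), Bminus_le_one (δ + x)]
  refine ⟨fun x => ?_, fun x _ => hin x, hout⟩
  by_cases hx : x ∈ Set.Ioo (-δ) δ
  · simpa [Set.indicator_of_mem hx] using hin x
  · simpa [Set.indicator_of_notMem hx] using hout x hx
end
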